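/- Let (X,d,W) be a uniformly convex hyperbolic space with a monotone modulus of uniform convexity η, C a nonempty convex subset of X that is bounded with diameter at most d_C > 0, T : C → C asymptotically nonexpansive with sequence (k_n), K ≥ 0 with Σ_{n=0}^∞ k_n ≤ K, and L ∈ ℕ, L ≥ 2, with 1/L ≤ λ_n ≤ 1 − 1/L for all n. Then T is λ_n-asymptotically regular, and for every x ∈ C and every ε ∈ (0,1] there exists N ≤ 2M with d(x_N, T x_N) < ε, where M := ⌈3(5KD + D + 11/2)/θ⌉, D := e^K·(d_C + 2), θ := (ε/(L²·f(K)))·η((1+K)D + 1, ε/(f(K)·((1+K)D + 1))), and f(K) := 2(1 + (1+K)²(2+K)). -/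

import Mathlib

open Filter Set

section Hyperbolic

variable {X : Type*}

/-- A hyperbolic space structure: `W x y t` represents `(1-t)x ⊕ t y`. -/
structure IsWMap [MetricSpace X] (W : X → X → ℝ → X) : Prop where
  w1 : ∀ (x y z : X), ∀ t ∈ Set.Icc (0:ℝ) 1,
    dist z (W x y t) ≤ (1 - t) * dist z x + t * dist z y
  w2 : ∀ (x y : X), ∀ t ∈ Set.Icc (0:ℝ) 1, ∀ s ∈ Set.Icc (0:ℝ) 1,
    dist (W x y t) (W x y s) = |t - s| * dist x y
  w3 : ∀ (x y : X), ∀ t ∈ Set.Icc (0:ℝ) 1, W x y t = W y x (1 - t)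
  w4 : ∀ (x y z w : X), ∀ t ∈ Set.Icc (0:ℝ) 1,
    dist (W x z t) (W y w t) ≤ (1 - t) * dist x y + t * dist z w

/-- `η` is a modulus of uniform convexity for the hyperbolic space `(X, dist, W)`. -/
def IsUCModulus [MetricSpace X] (W : X → X → ℝ → X) (η : ℝ → ℝ → ℝ) : Prop :=
  (∀ r ε : ℝ, 0 < r → ε ∈ Set.Ioc (0:ℝ) 2 → η r ε ∈ Set.Ioc (0:ℝ) 1) ∧
  (∀ r ε : ℝ, ∀ a x y : X, 0 < r → ε ∈ Set.Ioc (0:ℝ) 2 →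
    dist x a ≤ r → dist y a ≤ r → ε * r ≤ dist x y →
    dist (W x y (1/2)) a ≤ (1 - η r ε) * r)

/-- The modulus `η` is monotone: nonincreasing in `r` for each fixed `ε`. -/
def MonotoneUCModulus (η : ℝ → ℝ → ℝ) : Prop :=
  ∀ ε ∈ Set.Ioc (0:ℝ) 2, ∀ r s : ℝ, 0 < r → r ≤ s → η s ε ≤ η r ε

/-- `C` is a convex subset w.r.t. the convexity map `W`. -/
def WConvex [MetricSpace X] (W : X → X → ℝ → X) (C : Set X) : Prop :=
  ∀ x ∈ C, ∀ y ∈ C, ∀ t ∈ Set.Icc (0:ℝ) 1, W x y t ∈ C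

/-- `T : C → C` is asymptotically nonexpansive with sequence `k`. -/
def AsymptoticallyNonexpansive [MetricSpace X] (C : Set X) (T : X → X) (k : ℕ → ℝ) : Prop :=
  Set.MapsTo T C C ∧ (∀ n, 0 ≤ k n) ∧
  Filter.Tendsto k Filter.atTop (nhds 0) ∧
  ∀ n : ℕ, ∀ x ∈ C, ∀ y ∈ C, dist (T^[n] x) (T^[n] y) ≤ (1 + k n) * dist x y

/-- `xseq` is the Krasnoselski–Mann iteration of `T` starting from `x`:
`x₀ = x`, `x_{n+1} = (1-λ_n) x_n ⊕ λ_n T^n x_n`. -/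
def IsKMIteration [MetricSpace X] (W : X → X → ℝ → X) (T : X → X) (lam : ℕ → ℝ)
    (x : X) (xseq : ℕ → X) : Prop :=
  xseq 0 = x ∧ ∀ n, xseq (n + 1) = W (xseq n) (T^[n] (xseq n)) (lam n)

end Hyperbolic

section Hyperbolic

variable {X : Type*}

theorem IsWMap.eq_of_dist_le [MetricSpace X] {W : X → X → ℝ → X} {η : ℝ → ℝ → ℝ}
    (hW : IsWMap W) (hUC : IsUCModulus W η) {x y z w : X} {s t : ℝ}
    (hxz : dist x z ≤ s) (hxw : dist x w ≤ s) (hyz : dist y z ≤ t) (hyw : dist y w ≤ t)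
    (hst : s + t = dist x y) : z = w := by
  by_contra hne
  have hzw : 0 < dist z w := dist_pos.2 hne
  have htri : dist z w ≤ 2 * s := by linarith [dist_triangle_left z w x]
  have hs : 0 < s := by linarith
  have hε : dist z w / s ∈ Set.Ioc (0:ℝ) 2 := ⟨by positivity, by rwa [div_le_iff₀ hs]⟩
  have h := hUC.2 s _ x z w hs hε (by rwa [dist_comm]) (by rwa [dist_comm])
    (by rw [div_mul_cancel₀ _ hs.ne'])
  have hη := mul_pos (hUC.1 s _ hs hε).1 hs
  have h1 := hW.w1 z w y (1 / 2) ⟨by norm_num, by norm_num⟩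
  linarith [dist_triangle_right x y (W z w (1 / 2)), dist_comm x (W z w (1 / 2))]

theorem IsWMap.half_segment [MetricSpace X] {W : X → X → ℝ → X} {η : ℝ → ℝ → ℝ}
    (hW : IsWMap W) (hUC : IsUCModulus W η) (x y : X) {t : ℝ} (ht0 : 0 ≤ t) (ht : t ≤ 1 / 2) :
    W x y t = W x (W x y (1 / 2)) (2 * t) := by
  have hmem : (1 / 2 : ℝ) ∈ Set.Icc (0:ℝ) 1 := ⟨by norm_num, by norm_num⟩
  have htm : t ∈ Set.Icc (0:ℝ) 1 := ⟨ht0, by linarith⟩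
  have h2t : 2 * t ∈ Set.Icc (0:ℝ) 1 := ⟨by linarith, by linarith⟩
  have h1 := hW.w1 x y x _ htm
  have h2 := hW.w1 x y y _ htm
  have h3 := hW.w1 x y x _ hmem
  have h4 := hW.w1 x y y _ hmem
  have h5 := hW.w1 x (W x y (1 / 2)) x _ h2t
  have h6 := hW.w1 x (W x y (1 / 2)) y _ h2t
  simp only [dist_self, dist_comm y x] at h1 h2 h3 h4 h5 h6
  refine hW.eq_of_dist_le hUC (x := x) (y := y) (s := t * dist x y) (t := (1 - t) * dist x y)
    ?_ ?_ ?_ ?_ (by ring)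
  · linarith
  · nlinarith
  · linarith
  · nlinarith

theorem IsUCModulus.dist_convexComb_le [MetricSpace X] {W : X → X → ℝ → X} {η : ℝ → ℝ → ℝ}
    (hUC : IsUCModulus W η) (hW : IsWMap W) {x y a : X} {r ε l t : ℝ} (hr : 0 < r)
    (hε : ε ∈ Set.Ioc (0:ℝ) 2) (hx : dist x a ≤ r) (hy : dist y a ≤ r) (hxy : ε * r ≤ dist x y)
    (hl : 0 ≤ l) (hlt : l ≤ t) (htl : t ≤ 1 - l) :
    dist (W x y t) a ≤ (1 - 2 * l * η r ε) * r := by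
  wlog ht : t ≤ 1 / 2 generalizing x y t
  · rw [hW.w3 x y t ⟨by linarith, by linarith⟩]
    exact this hy hx (by rwa [dist_comm]) (by linarith) (by linarith) (by linarith)
  rw [hW.half_segment hUC x y (by linarith) ht]
  have h1 := hW.w1 x (W x y (1 / 2)) a (2 * t) ⟨by linarith, by linarith⟩
  have h2 := hUC.2 r ε a x y hr hε hx hy hxy
  have hη := mul_pos (hUC.1 r ε hr hε).1 hr
  rw [dist_comm] at hx h2 ⊢
  have h3 : (1 - 2 * t) * dist a x ≤ (1 - 2 * t) * r :=
    mul_le_mul_of_nonneg_left hx (by linarith)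
  have h4 : 2 * t * dist a (W x y (1 / 2)) ≤ 2 * t * ((1 - η r ε) * r) :=
    mul_le_mul_of_nonneg_left h2 (by linarith)
  have h5 : l * (η r ε * r) ≤ t * (η r ε * r) := mul_le_mul_of_nonneg_right hlt hη.le
  linarith

/-- Uniform convexity combined with monotonicity: the gain can be bounded below uniformly over all
radii `r ≤ R`. -/
theorem IsUCModulus.dist_convexComb_le_sub [MetricSpace X] {W : X → X → ℝ → X} {η : ℝ → ℝ → ℝ}
    (hUC : IsUCModulus W η) (hMon : MonotoneUCModulus η) (hW : IsWMap W) {x y a : X}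
    {r R σ l t : ℝ} (hrR : r ≤ R) (hσ : 0 < σ) (hσR : σ ≤ 2 * R)
    (hx : dist x a ≤ r) (hy : dist y a ≤ r) (hxy : σ ≤ dist x y)
    (hl : 0 ≤ l) (hlt : l ≤ t) (htl : t ≤ 1 - l) :
    dist (W x y t) a ≤ r - l * σ * η R (σ / R) := by
  have hr2 : σ ≤ 2 * r := by linarith [dist_triangle_right x y a]
  have hr : 0 < r := by linarith
  have hR : 0 < R := by linarith
  have hε : σ / R ∈ Set.Ioc (0:ℝ) 2 := ⟨by positivity, by rwa [div_le_iff₀ hR]⟩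
  have h1 : σ / R * r ≤ dist x y := by
    refine le_trans ?_ hxy
    rw [div_mul_eq_mul_div, div_le_iff₀ hR]
    exact mul_le_mul_of_nonneg_left hrR hσ.le
  refine (hUC.dist_convexComb_le hW hr hε hx hy h1 hl hlt htl).trans ?_
  have h2 := hMon _ hε r R hr hrR
  have h3 := (hUC.1 R _ hR hε).1
  have h4 : σ * η R (σ / R) ≤ 2 * r * η r (σ / R) := by gcongr
  have h5 := mul_le_mul_of_nonneg_left h4 hl
  linarith

theorem exists_dist_map_lt [MetricSpace X] {W : X → X → ℝ → X} {η : ℝ → ℝ → ℝ}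
    (hW : IsWMap W) (hUC : IsUCModulus W η) (hMon : MonotoneUCModulus η)
    {C : Set X} (hne : C.Nonempty) (hconv : WConvex W C)
    {dC : ℝ} (hdiam : ∀ p ∈ C, ∀ q ∈ C, dist p q ≤ dC)
    {T : X → X} {k : ℕ → ℝ} (hT : AsymptoticallyNonexpansive C T k) {δ : ℝ} (hδ : 0 < δ) :
    ∃ p ∈ C, dist (T p) p < δ := by
  obtain ⟨hmaps, hk0, hk, hlip⟩ := hT
  obtain ⟨y, hy⟩ := hne
  have hTC : ∀ n, ∀ q ∈ C, T^[n] q ∈ C := fun n q hq => hmaps.iterate n hq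
  have hdC : 0 ≤ dC := dist_nonneg.trans (hdiam y hy y hy)
  set τ := δ / (2 + k 1) with hτ
  have hk1 := hk0 1
  have hτ0 : 0 < τ := by positivity
  set R := dC + 2 + τ with hR
  have hR0 : 0 < R := by positivity
  have hηpos : 0 < η R (τ / R) :=
    (hUC.1 R (τ / R) hR0 ⟨by positivity, by rw [div_le_iff₀ hR0]; linarith⟩).1
  set S : Set ℝ := {s | ∃ z ∈ C, ∃ n₀, ∀ n ≥ n₀, dist z (T^[n] y) ≤ s} with hS
  have hSbdd : BddBelow S :=
    ⟨0, fun s ⟨z, _, n₀, h⟩ => dist_nonneg.trans (h n₀ le_rfl)⟩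
  have hSmem : dC ∈ S := ⟨y, hy, 0, fun n _ => hdiam _ hy _ (hTC n y hy)⟩
  have hρ : sInf S ≤ dC := csInf_le hSbdd hSmem
  set γ := min 1 (1 / 2 * τ * η R (τ / R) / 2) with hγ
  have hγ0 : 0 < γ := by positivity
  have hγ1 : γ ≤ 1 := min_le_left _ _
  have hγ2 : γ ≤ 1 / 2 * τ * η R (τ / R) / 2 := min_le_right _ _
  obtain ⟨s, ⟨z, hz, n₀, hn₀⟩, hs⟩ := exists_lt_of_csInf_lt ⟨dC, hSmem⟩
    (show sInf S < sInf S + γ by linarith)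
  have hev : ∀ᶠ m in atTop, k m * dC < γ := by
    have : Tendsto (fun m => k m * dC) atTop (nhds 0) := by simpa using hk.mul_const dC
    exact this.eventually_lt_const hγ0
  obtain ⟨m₀, hm₀⟩ := eventually_atTop.1 hev
  have hclose : ∀ m ≥ m₀, dist z (T^[m] z) < τ := by
    intro m hm
    by_contra! hge
    have hmem : s + γ - 1 / 2 * τ * η R (τ / R) ∈ S := by
      refine ⟨W z (T^[m] z) (1 / 2),
        hconv z hz _ (hTC m z hz) _ ⟨by norm_num, by norm_num⟩, n₀ + m, fun n hn => ?_⟩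
      refine hUC.dist_convexComb_le_sub hMon hW (by linarith) hτ0 (by linarith) ?_ ?_ hge
        (by norm_num) (by norm_num) (by norm_num)
      · linarith [hn₀ n (by omega)]
      · obtain ⟨j, rfl⟩ : ∃ j, n = m + j := ⟨n - m, by omega⟩
        rw [Function.iterate_add_apply]
        have h1 := hlip m z hz _ (hTC j y hy)
        have h2 := mul_le_mul_of_nonneg_left (hdiam z hz _ (hTC j y hy)) (hk0 m)
        linarith [hn₀ j (by omega), hm₀ m hm]
    linarith [csInf_le hSbdd hmem]
  refine ⟨z, hz, ?_⟩
  have h1 := hclose m₀ le_rfl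
  have h2 := hclose (m₀ + 1) (by omega)
  have h3 := hlip 1 z hz _ (hTC m₀ z hz)
  simp only [Function.iterate_one] at h3
  rw [Function.iterate_succ_apply'] at h2
  have h4 : (1 + k 1) * dist z (T^[m₀] z) ≤ (1 + k 1) * τ :=
    mul_le_mul_of_nonneg_left h1.le (by linarith)
  have h5 : (2 + k 1) * τ = δ := by rw [hτ]; field_simp
  linarith [dist_triangle_right (T z) z (T (T^[m₀] z))]

theorem AsymptoticallyNonexpansive.dist_iterate_le [MetricSpace X] {C : Set X} {T : X → X}
    {k : ℕ → ℝ} (hT : AsymptoticallyNonexpansive C T k) {K : ℝ} (hkK : ∀ n, k n ≤ K)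
    {p : X} (hp : p ∈ C) (n : ℕ) : dist (T^[n] p) p ≤ n * ((1 + K) * dist (T p) p) := by
  induction n with
  | zero => simp
  | succ n ih =>
    have h1 := hT.2.2.2 n (T p) (hT.1 hp) p hp
    rw [← Function.iterate_succ_apply] at h1
    have h2 := mul_le_mul_of_nonneg_right (hkK n) (dist_nonneg (x := T p) (y := p))
    push_cast
    linarith [dist_triangle (T^[n + 1] p) (T^[n] p) p]

theorem exists_forall_dist_iterate_le [MetricSpace X] {W : X → X → ℝ → X} {η : ℝ → ℝ → ℝ}
    (hW : IsWMap W) (hUC : IsUCModulus W η) (hMon : MonotoneUCModulus η)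
    {C : Set X} (hne : C.Nonempty) (hconv : WConvex W C)
    {dC : ℝ} (hdiam : ∀ p ∈ C, ∀ q ∈ C, dist p q ≤ dC)
    {T : X → X} {k : ℕ → ℝ} (hT : AsymptoticallyNonexpansive C T k)
    {K : ℝ} (hkK : ∀ n, k n ≤ K) (N : ℕ) {δ : ℝ} (hδ : 0 < δ) :
    ∃ p ∈ C, ∀ n ≤ N, dist (T^[n] p) p ≤ δ := by
  have hK : 0 ≤ K := (hT.2.1 0).trans (hkK 0)
  have hpos : 0 < ((N : ℝ) + 1) * (1 + K) := by positivity
  obtain ⟨p, hp, hpδ⟩ := exists_dist_map_lt hW hUC hMon hne hconv hdiam hT (div_pos hδ hpos)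
  refine ⟨p, hp, fun n hn => (hT.dist_iterate_le hkK hp n).trans ?_⟩
  rw [lt_div_iff₀ hpos] at hpδ
  have h1 : (n : ℝ) ≤ N + 1 := by exact_mod_cast hn.trans (Nat.le_succ N)
  have h2 : (n : ℝ) * ((1 + K) * dist (T p) p) ≤ (N + 1) * ((1 + K) * dist (T p) p) := by gcongr
  linarith

theorem IsKMIteration.mem [MetricSpace X] {W : X → X → ℝ → X} {C : Set X} (hconv : WConvex W C)
    {T : X → X} (hT : MapsTo T C C) {lam : ℕ → ℝ} (hlam : ∀ n, lam n ∈ Set.Icc (0:ℝ) 1)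
    {x : X} (hx : x ∈ C) {u : ℕ → X} (hu : IsKMIteration W T lam x u) (n : ℕ) : u n ∈ C := by
  induction n with
  | zero => rw [hu.1]; exact hx
  | succ n ih => rw [hu.2]; exact hconv _ ih _ (hT.iterate n ih) _ (hlam n)

/-- The number of indices at which `d(xₙ, Tⁿ xₙ)` is at least `σ` is bounded uniformly. -/
theorem IsKMIteration.sum_gain_le [MetricSpace X] {W : X → X → ℝ → X} {η : ℝ → ℝ → ℝ}
    (hW : IsWMap W) (hUC : IsUCModulus W η) (hMon : MonotoneUCModulus η)
    {C : Set X} (hconv : WConvex W C)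
    {dC : ℝ} (hdiam : ∀ p ∈ C, ∀ q ∈ C, dist p q ≤ dC)
    {T : X → X} {k : ℕ → ℝ} (hT : AsymptoticallyNonexpansive C T k)
    {K : ℝ} (hsum : ∀ n : ℕ, ∑ i ∈ Finset.range n, k i ≤ K) (hkK : ∀ n, k n ≤ K)
    {l : ℝ} (hl : 0 ≤ l) {lam : ℕ → ℝ} (hlam : ∀ n, l ≤ lam n ∧ lam n ≤ 1 - l)
    {x : X} (hx : x ∈ C) {u : ℕ → X} (hu : IsKMIteration W T lam x u)
    {σ R : ℝ} (hσ : 0 < σ) (hσR : σ ≤ 2 * R) (hR : (1 + K) * dC + 1 ≤ R) (N : ℕ) :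
    ∑ n ∈ Finset.range N, (if σ ≤ dist (u n) (T^[n] (u n)) then l * σ * η R (σ / R) else 0)
      ≤ (1 + K) * dC := by
  have hlam' : ∀ n, lam n ∈ Set.Icc (0:ℝ) 1 := fun n =>
    ⟨hl.trans (hlam n).1, by linarith [(hlam n).2]⟩
  have hmem := hu.mem hconv hT.1 hlam' hx
  have hdC : 0 ≤ dC := dist_nonneg.trans (hdiam x hx x hx)
  refine le_of_forall_pos_le_add fun e he => ?_
  set δ := min 1 (e / (N + 1)) with hδ
  have hδ0 : 0 < δ := by positivity
  have hδ1 : δ ≤ 1 := min_le_left _ _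
  have hδe : N * δ ≤ e := by
    have h1 : δ ≤ e / (N + 1) := min_le_right _ _
    rw [le_div_iff₀ (by positivity)] at h1
    linarith
  obtain ⟨p, hp, hpδ⟩ := exists_forall_dist_iterate_le hW hUC hMon ⟨x, hx⟩ hconv hdiam hT hkK N hδ0
  have hstep : ∀ n ≤ N, dist (u (n + 1)) p +
      (if σ ≤ dist (u n) (T^[n] (u n)) then l * σ * η R (σ / R) else 0)
      ≤ dist (u n) p + k n * dC + δ := by
    intro n hn
    have ha : dist (u n) p ≤ dC := hdiam _ (hmem n) _ hp
    have hk0 := hT.2.1 n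
    have hka : k n * dist (u n) p ≤ k n * dC := mul_le_mul_of_nonneg_left ha hk0
    have hkC : k n * dC ≤ K * dC := mul_le_mul_of_nonneg_right (hkK n) hdC
    have hb : dist (T^[n] (u n)) p ≤ dist (u n) p + k n * dC + δ := by
      linarith [dist_triangle (T^[n] (u n)) (T^[n] p) p, hpδ n hn,
        hT.2.2.2 n _ (hmem n) p hp]
    have ha' : dist (u n) p ≤ dist (u n) p + k n * dC + δ := by
      linarith [mul_nonneg hk0 hdC]
    rw [hu.2 n]
    split_ifs with h
    · have := hUC.dist_convexComb_le_sub hMon hW (R := R) (by linarith) hσ hσR ha' hb h hl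
        (hlam n).1 (hlam n).2
      linarith
    · have h1 := hW.w1 (u n) (T^[n] (u n)) p (lam n) (hlam' n)
      rw [dist_comm p, dist_comm p, dist_comm p] at h1
      have h2 := mul_le_mul_of_nonneg_left ha' (sub_nonneg.2 (hlam' n).2)
      have h3 := mul_le_mul_of_nonneg_left hb (hlam' n).1
      linarith
  have htel : ∀ m ≤ N, dist (u m) p +
      ∑ n ∈ Finset.range m, (if σ ≤ dist (u n) (T^[n] (u n)) then l * σ * η R (σ / R) else 0)
      ≤ dC + (∑ n ∈ Finset.range m, k n) * dC + m * δ := by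
    intro m
    induction m with
    | zero => intro _; simpa using hdiam _ (hmem 0) _ hp
    | succ m ih =>
      intro hm
      rw [Finset.sum_range_succ, Finset.sum_range_succ]
      push_cast
      linarith [ih (by omega), hstep m (by omega)]
  have h1 := mul_le_mul_of_nonneg_right (hsum N) hdC
  linarith [htel N le_rfl, dist_nonneg (x := u N) (y := p)]

theorem IsKMIteration.dist_succ_map_le [MetricSpace X] {W : X → X → ℝ → X} (hW : IsWMap W)
    {C : Set X} {T : X → X} {k : ℕ → ℝ} (hT : AsymptoticallyNonexpansive C T k)
    {K : ℝ} (hkK : ∀ n, k n ≤ K) {lam : ℕ → ℝ} (hlam : ∀ n, lam n ∈ Set.Icc (0:ℝ) 1)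
    {x : X} {u : ℕ → X} (hu : IsKMIteration W T lam x u) (hmem : ∀ n, u n ∈ C) (n : ℕ) :
    dist (u (n + 1)) (T (u (n + 1))) ≤
      dist (u (n + 1)) (T^[n + 1] (u (n + 1))) + (1 + K) ^ 2 * dist (u n) (T^[n] (u n)) := by
  have hK : 0 ≤ K := (hT.2.1 0).trans (hkK 0)
  obtain ⟨h0, h1⟩ := hlam n
  set c := dist (u n) (T^[n] (u n)) with hc
  have hc0 : 0 ≤ c := dist_nonneg
  have e1 := hW.w1 (u n) (T^[n] (u n)) (u n) (lam n) ⟨h0, h1⟩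
  have e2 := hW.w1 (u n) (T^[n] (u n)) (T^[n] (u n)) (lam n) ⟨h0, h1⟩
  rw [← hu.2 n, dist_self, ← hc] at e1
  rw [← hu.2 n, dist_self, dist_comm _ (u n), ← hc] at e2
  have e3 : dist (T^[n] (u (n + 1))) (T^[n] (u n)) ≤ (1 + K) * (lam n * c) := by
    refine (hT.2.2.2 n _ (hmem (n + 1)) _ (hmem n)).trans ?_
    rw [dist_comm (u (n + 1))]
    have := hkK n
    gcongr
    linarith
  have e4 : dist (T^[n] (u (n + 1))) (u (n + 1)) ≤ (1 + K) * c := by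
    have : 0 ≤ K * ((1 - lam n) * c) := mul_nonneg hK (mul_nonneg (sub_nonneg.2 h1) hc0)
    linarith [dist_triangle (T^[n] (u (n + 1))) (T^[n] (u n)) (u (n + 1))]
  have e5 : dist (T^[n + 1] (u (n + 1))) (T (u (n + 1))) ≤ (1 + K) * ((1 + K) * c) := by
    rw [Function.iterate_succ_apply']
    have h := hT.2.2.2 1 _ (hT.1.iterate n (hmem (n + 1))) _ (hmem (n + 1))
    simp only [Function.iterate_one] at h
    refine h.trans ?_
    have := hkK 1
    gcongr
  linarith [dist_triangle (u (n + 1)) (T^[n + 1] (u (n + 1))) (T (u (n + 1)))]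

theorem tendsto_zero_of_sum_ite_le {c : ℕ → ℝ} (hc : ∀ n, 0 ≤ c n)
    (h : ∀ σ > 0, ∃ g > 0, ∃ B, ∀ N, ∑ n ∈ Finset.range N, (if σ ≤ c n then g else 0) ≤ (B : ℝ)) :
    Tendsto c atTop (nhds 0) := by
  rw [Metric.tendsto_atTop]
  intro σ hσ
  obtain ⟨g, hg, B, hB⟩ := h σ hσ
  have hs : Summable fun n => if σ ≤ c n then g else 0 :=
    summable_of_sum_range_le (fun n => by split_ifs <;> linarith) hB
  obtain ⟨n₀, hn₀⟩ := eventually_atTop.1 (hs.tendsto_atTop_zero.eventually_lt_const hg)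
  refine ⟨n₀, fun n hn => ?_⟩
  have := hn₀ n hn
  rw [Real.dist_eq, sub_zero, abs_of_nonneg (hc n)]
  by_contra! hlt
  simp [hlt] at this

theorem mul_le_sum_range_two_mul {f : ℕ → ℝ} {g : ℝ} {M : ℕ}
    (h : ∀ j < M, g ≤ f (2 * j) + f (2 * j + 1)) : M * g ≤ ∑ n ∈ Finset.range (2 * M), f n := by
  induction M with
  | zero => simp
  | succ M ih =>
    rw [show 2 * (M + 1) = 2 * M + 1 + 1 by ring, Finset.sum_range_succ, Finset.sum_range_succ]
    push_cast
    linarith [ih fun j hj => h j (by omega), h M (by omega)]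

end Hyperbolic

/-- bounded `C`: asymptotic regularity plus a uniform rate depending only on
`K, L, d_C, η, ε`. -/
theorem asymptotic_regularity_bounded_C
    {X : Type*} [MetricSpace X]
    (W : X → X → ℝ → X) (η : ℝ → ℝ → ℝ)
    (hW : IsWMap W) (hUC : IsUCModulus W η) (hMon : MonotoneUCModulus η)
    (C : Set X) (hne : C.Nonempty) (hconv : WConvex W C)
    (dC : ℝ) (hdC : 0 < dC) (hdiam : ∀ p ∈ C, ∀ q ∈ C, dist p q ≤ dC)
    (T : X → X) (k : ℕ → ℝ) (hT : AsymptoticallyNonexpansive C T k)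
    (K : ℝ) (hK : 0 ≤ K) (hsum : ∀ n : ℕ, ∑ i ∈ Finset.range n, k i ≤ K)
    (L : ℕ) (hL : 2 ≤ L) (lam : ℕ → ℝ)
    (hlam : ∀ n, 1 / (L : ℝ) ≤ lam n ∧ lam n ≤ 1 - 1 / (L : ℝ)) :
    ∀ x ∈ C, ∀ xseq : ℕ → X, IsKMIteration W T lam x xseq →
      Filter.Tendsto (fun n => dist (xseq n) (T (xseq n))) Filter.atTop (nhds 0) ∧
      ∀ ε : ℝ, 0 < ε → ε ≤ 1 →
        ∀ (fK D θ : ℝ) (M : ℕ),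
          fK = 2 * (1 + (1 + K) ^ 2 * (2 + K)) →
          D = Real.exp K * (dC + 2) →
          θ = ε / ((L : ℝ) ^ 2 * fK) * η ((1 + K) * D + 1) (ε / (fK * ((1 + K) * D + 1))) →
          M = ⌈3 * (5 * K * D + D + 11 / 2) / θ⌉₊ →
          ∃ N ≤ 2 * M, dist (xseq N) (T (xseq N)) < ε := by
  intro x hx u hu
  have hkK : ∀ n, k n ≤ K := fun n =>
    (Finset.single_le_sum (fun i _ => hT.2.1 i) (Finset.self_mem_range_succ n)).trans (hsum (n + 1))
  have hL2 : (2 : ℝ) ≤ L := by exact_mod_cast hL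
  have hL0 : (0 : ℝ) < L := by linarith
  have hl : 0 < 1 / (L : ℝ) := by positivity
  have hlam' : ∀ n, lam n ∈ Set.Icc (0:ℝ) 1 := fun n =>
    ⟨hl.le.trans (hlam n).1, by linarith [(hlam n).2]⟩
  have hmem := hu.mem hconv hT.1 hlam' hx
  have hstep := hu.dist_succ_map_le hW hT hkK hlam' hmem
  have hgain {σ R : ℝ} := hu.sum_gain_le hW hUC hMon hconv hdiam hT hsum hkK hl.le hlam hx
    (σ := σ) (R := R)
  have hKd : 0 ≤ (1 + K) * dC := by positivity
  constructor
  · have hc : Tendsto (fun n => dist (u n) (T^[n] (u n))) atTop (nhds 0) := by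
      refine tendsto_zero_of_sum_ite_le (fun n => dist_nonneg) fun σ hσ => ?_
      have hR : 0 < (1 + K) * dC + 1 + σ := by positivity
      have hη := (hUC.1 _ (σ / ((1 + K) * dC + 1 + σ)) hR
        ⟨by positivity, by rw [div_le_iff₀ hR]; linarith⟩).1
      exact ⟨_, by positivity, _, hgain hσ (by linarith) (by linarith)⟩
    rw [← tendsto_add_atTop_iff_nat 1]
    refine squeeze_zero (fun n => dist_nonneg) hstep ?_
    simpa using ((tendsto_add_atTop_iff_nat 1).2 hc).add (hc.const_mul ((1 + K) ^ 2))
  · rintro ε hε hε1 fK D θ M hf hD hθ hM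
    have hf2 : 2 ≤ fK := by
      have : 0 ≤ (1 + K) ^ 2 * (2 + K) := by positivity
      linarith
    have hf0 : 0 < fK := by linarith
    have hDd : dC ≤ D := by
      have := Real.one_le_exp hK
      rw [hD]; nlinarith
    have hD0 : 0 < D := by linarith
    have hR : 1 ≤ (1 + K) * D + 1 := by
      have : 0 ≤ (1 + K) * D := by positivity
      linarith
    have hσ : 0 < ε / fK := by positivity
    have hσ1 : ε / fK ≤ 1 := by rw [div_le_one hf0]; linarith
    have hη : 0 < η ((1 + K) * D + 1) (ε / (fK * ((1 + K) * D + 1))) := by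
      rw [← div_div]
      refine (hUC.1 _ _ (by linarith) ⟨by positivity, ?_⟩).1
      rw [div_le_iff₀ (by linarith)]
      linarith
    have hθ0 : 0 < θ := by rw [hθ]; positivity
    have hθg : θ ≤ 1 / L * (ε / fK) * η ((1 + K) * D + 1) (ε / fK / ((1 + K) * D + 1)) := by
      rw [hθ, div_div ε fK]
      gcongr
      rw [div_mul_div_comm, one_mul]
      gcongr
      nlinarith
    have hMθ : 3 * (5 * K * D + D + 11 / 2) ≤ M * θ := by
      rw [← div_le_iff₀ hθ0, hM]
      exact Nat.le_ceil _
    have hKD : (1 + K) * dC ≤ (1 + K) * D := by gcongr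
    by_contra! hbad
    have hsumM := hgain (R := (1 + K) * D + 1) hσ (by linarith) (by linarith) (2 * M)
    refine absurd ((mul_le_sum_range_two_mul (g := θ) fun j hj => ?_).trans hsumM) ?_
    · by_cases h1 : ε / fK ≤ dist (u (2 * j)) (T^[2 * j] (u (2 * j)))
      · rw [if_pos h1]
        split_ifs <;> linarith
      by_cases h2 : ε / fK ≤ dist (u (2 * j + 1)) (T^[2 * j + 1] (u (2 * j + 1)))
      · rw [if_neg h1, if_pos h2]
        linarith
      push Not at h1 h2
      have h3 := hstep (2 * j)
      have h4 := hbad (2 * j + 1) (by omega)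
      have h5 : (1 + K) ^ 2 * dist (u (2 * j)) (T^[2 * j] (u (2 * j))) ≤ (1 + K) ^ 2 * (ε / fK) := by
        gcongr
      have h6 : fK * (ε / fK) = ε := mul_div_cancel₀ _ hf0.ne'
      have h7 : (1 + (1 + K) ^ 2) * (ε / fK) ≤ fK * (ε / fK) := by
        have : 0 ≤ (1 + K) ^ 2 * (1 + K) := by positivity
        gcongr
        nlinarith [sq_nonneg (1 + K)]
      linarith
    · push Not
      have : 0 ≤ K * D := by positivity
      linarith
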